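/- For every ρ ∈ (0, ρ̄): g_ρ(d(ρ) + ε) < 0 for every ε > 0, and g_ρ(d(ρ) − ε) > 0 for every ε ∈ (0, d(ρ)). -/

import Mathlib

open MeasureTheory Filter Set Topology

open scoped Classical in
/-- Cumulant generating function valued in `EReal` (equal to `+∞` where the
moment generating function is infinite). -/
noncomputable def cgfE {Ω : Type*} [MeasurableSpace Ω] (μ : Measure Ω) (X : Ω → ℝ) (t : ℝ) :
    EReal :=
  if Integrable (fun ω => Real.exp (t * X ω)) μ then
    ((Real.log (∫ ω, Real.exp (t * X ω) ∂μ) : ℝ) : EReal)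
  else ⊤

/-- Real-valued version of the cumulant generating function (meaningful where the
moment generating function is finite). -/
noncomputable def cgfR {Ω : Type*} [MeasurableSpace Ω] (μ : Measure Ω) (X : Ω → ℝ) (t : ℝ) :
    ℝ :=
  Real.log (∫ ω, Real.exp (t * X ω) ∂μ)

/-- The Cramér (Legendre) rate function `I(x) = sup_t (t x - Λ(t))`, valued in `[0,∞]`. -/
noncomputable def rateI {Ω : Type*} [MeasurableSpace Ω] (μ : Measure Ω) (X : Ω → ℝ) (x : ℝ) :
    EReal :=
  ⨆ t : ℝ, (((t * x : ℝ) : EReal) - cgfE μ X t)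

/-- `λ* = sup {λ ≥ 0 : E[exp(λ X)] < ∞}`, valued in `EReal`. -/
noncomputable def lamStar {Ω : Type*} [MeasurableSpace Ω] (μ : Measure Ω) (X : Ω → ℝ) :
    EReal :=
  sSup {l : EReal | ∃ lr : ℝ, l = (lr : EReal) ∧ 0 ≤ lr ∧
    Integrable (fun ω => Real.exp (lr * X ω)) μ}

/-- `x* = sup {x ≥ 0 : I(x) ≤ log m}`. -/
noncomputable def xStar {Ω : Type*} [MeasurableSpace Ω] (μ : Measure Ω) (X : Ω → ℝ)
    (m : ℝ) : ℝ :=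
  sSup {x : ℝ | 0 ≤ x ∧ rateI μ X x ≤ ((Real.log m : ℝ) : EReal)}

/-- `f(ρ) = log m − I(θx*/(1−ρ)) − a/(1−ρ)`, valued in `[-∞,∞)`. -/
noncomputable def fF {Ω : Type*} [MeasurableSpace Ω] (μ : Measure Ω) (X : Ω → ℝ)
    (m θ a ρ : ℝ) : EReal :=
  ((Real.log m : ℝ) : EReal) - rateI μ X (θ * xStar μ X m / (1 - ρ)) -
    ((a / (1 - ρ) : ℝ) : EReal)

/-- `ρ̄ = sup {ρ ∈ (0,1) : f(ρ) ≥ 0}`. -/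
noncomputable def rhoBar {Ω : Type*} [MeasurableSpace Ω] (μ : Measure Ω) (X : Ω → ℝ)
    (m θ a : ℝ) : ℝ :=
  sSup {ρ : ℝ | 0 < ρ ∧ ρ < 1 ∧ 0 ≤ fF μ X m θ a ρ}

/-- `g_ρ(h) = log m − I((h + θx*)/(1−ρ)) − a/(1−ρ)`, valued in `[-∞,∞)`.
(For `ρ = 0` this is the convention `g_0(h) = log m − I(h + θx*) − a`.) -/
noncomputable def gG {Ω : Type*} [MeasurableSpace Ω] (μ : Measure Ω) (X : Ω → ℝ)
    (m θ a ρ h : ℝ) : EReal :=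
  ((Real.log m : ℝ) : EReal) - rateI μ X ((h + θ * xStar μ X m) / (1 - ρ)) -
    ((a / (1 - ρ) : ℝ) : EReal)

/-- `d(ρ) = sup {h ≥ 0 : g_ρ(h) ≥ 0}`. -/
noncomputable def dD {Ω : Type*} [MeasurableSpace Ω] (μ : Measure Ω) (X : Ω → ℝ)
    (m θ a ρ : ℝ) : ℝ :=
  sSup {h : ℝ | 0 ≤ h ∧ 0 ≤ gG μ X m θ a ρ h}

/-- The rate function is at most `c` exactly when every finite term of the supremum is. -/
lemma rateI_le_coe_iff {Ω : Type*} [MeasurableSpace Ω] {μ : Measure Ω} {X : Ω → ℝ} {x c : ℝ} :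
    rateI μ X x ≤ (c : EReal) ↔
      ∀ t : ℝ, Integrable (fun ω => Real.exp (t * X ω)) μ → t * x - cgfR μ X t ≤ c := by
  unfold rateI
  rw [iSup_le_iff]
  refine forall_congr' fun t => ?_
  unfold cgfE cgfR
  split_ifs with h
  · simp only [h, forall_true_left]
    rw [← EReal.coe_sub, EReal.coe_le_coe_iff]
  · simp [h]

/-- The cumulant generating function of a centred variable is nonnegative. -/
lemma cgfR_nonneg {Ω : Type*} [MeasurableSpace Ω] {μ : Measure Ω} [IsProbabilityMeasure μ]
    {X : Ω → ℝ} (hint : Integrable X μ) (hmean : ∫ ω, X ω ∂μ = 0) {t : ℝ}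
    (ht : Integrable (fun ω => Real.exp (t * X ω)) μ) : 0 ≤ cgfR μ X t := by
  apply Real.log_nonneg
  have hle : ∫ ω, (t * X ω + 1) ∂μ ≤ ∫ ω, Real.exp (t * X ω) ∂μ :=
    integral_mono ((hint.const_mul t).add (integrable_const 1)) ht
      fun ω => Real.add_one_le_exp (t * X ω)
  rw [integral_add (hint.const_mul t) (integrable_const 1), integral_const_mul, hmean] at hle
  simpa using hle

lemma rateI_nonneg {Ω : Type*} [MeasurableSpace Ω] (μ : Measure Ω) [IsProbabilityMeasure μ]
    (X : Ω → ℝ) (x : ℝ) : 0 ≤ rateI μ X x := by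
  refine le_trans ?_ (le_iSup _ (0 : ℝ))
  simp [cgfE]

/-- Convexity of the rate function along rays, where it vanishes at the origin. -/
lemma rateI_mul_le {Ω : Type*} [MeasurableSpace Ω] {μ : Measure Ω} [IsProbabilityMeasure μ]
    {X : Ω → ℝ} (hint : Integrable X μ) (hmean : ∫ ω, X ω ∂μ = 0) {s x c : ℝ}
    (hs0 : 0 ≤ s) (hs1 : s ≤ 1) (h : rateI μ X x ≤ (c : EReal)) :
    rateI μ X (s * x) ≤ ((s * c : ℝ) : EReal) := by
  rw [rateI_le_coe_iff] at h ⊢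
  intro t ht
  have h1 := mul_le_mul_of_nonneg_left (h t ht) hs0
  have h2 := mul_le_mul_of_nonneg_right hs1 (cgfR_nonneg hint hmean ht)
  linarith

lemma EReal.coe_sub_sub_coe_nonneg_iff {l b : ℝ} {r : EReal} (hr : 0 ≤ r) :
    0 ≤ (l : EReal) - r - (b : EReal) ↔ r ≤ ((l - b : ℝ) : EReal) := by
  induction r with
  | bot => simp at hr
  | top => simp [-EReal.coe_sub]
  | coe r =>
    norm_cast
    constructor <;> intro h <;> linarith

lemma EReal.coe_sub_sub_coe_pos_iff {l b : ℝ} {r : EReal} (hr : 0 ≤ r) :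
    0 < (l : EReal) - r - (b : EReal) ↔ r < ((l - b : ℝ) : EReal) := by
  induction r with
  | bot => simp at hr
  | top => simp
  | coe r =>
    norm_cast
    constructor <;> intro h <;> linarith

theorem stmt8 {Ω : Type*} [MeasurableSpace Ω] (μ : Measure Ω) [IsProbabilityMeasure μ]
    (X : Ω → ℝ) (hmeas : Measurable X) (hint : Integrable X μ)
    (hmean : ∫ ω, X ω ∂μ = 0) (hX0 : μ {ω | X ω = 0} < 1)
    (hmom : ∃ κ : ℝ, 0 < κ ∧ Integrable (fun ω => Real.exp (κ * X ω)) μ)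
    (hmom' : ∃ κ' : ℝ, κ' < 0 ∧ Integrable (fun ω => Real.exp (κ' * X ω)) μ)
    (m θ a p₁ : ℝ) (hm : 1 < m) (hθ0 : 0 ≤ θ) (hθ1 : θ < 1)
    (hp₁ : 0 < p₁ ∧ p₁ < 1)
    (ha0 : 0 ≤ a) (ha : (a : EReal) < ((Real.log m : ℝ) : EReal) - rateI μ X (θ * xStar μ X m))
    (hxB : BddAbove {x : ℝ | 0 ≤ x ∧ rateI μ X x ≤ ((Real.log m : ℝ) : EReal)})
    (hxpos : 0 < xStar μ X m) :
    ∀ ρ : ℝ, 0 < ρ → ρ < rhoBar μ X m θ a →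
      (∀ ε : ℝ, 0 < ε → gG μ X m θ a ρ (dD μ X m θ a ρ + ε) < 0) ∧
      (∀ ε : ℝ, 0 < ε → ε < dD μ X m θ a ρ → 0 < gG μ X m θ a ρ (dD μ X m θ a ρ - ε)) := by
  intro ρ hρ0 hρ
  have hθx : 0 ≤ θ * xStar μ X m := mul_nonneg hθ0 hxpos.le
  have gG_nonneg_iff (h : ℝ) := EReal.coe_sub_sub_coe_nonneg_iff (l := Real.log m)
    (b := a / (1 - ρ)) (rateI_nonneg μ X ((h + θ * xStar μ X m) / (1 - ρ)))
  obtain ⟨ρ', ⟨-, hρ'1, hf⟩, hρρ'⟩ : ∃ ρ' ∈ {ρ : ℝ | 0 < ρ ∧ ρ < 1 ∧ 0 ≤ fF μ X m θ a ρ},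
      ρ < ρ' := by
    refine exists_lt_of_lt_csSup (Set.nonempty_iff_ne_empty.2 fun hempty => ?_) hρ
    rw [rhoBar, hempty, Real.sSup_empty] at hρ
    exact hρ.not_gt hρ0
  have hρ1 : 0 < 1 - ρ := by linarith
  have hc : 0 < Real.log m - a / (1 - ρ) := by
    have hlog : 0 < Real.log m := Real.log_pos hm
    have hnonneg : 0 ≤ Real.log m - a / (1 - ρ') := by
      have hr := rateI_nonneg μ X (θ * xStar μ X m / (1 - ρ'))
      exact_mod_cast hr.trans ((EReal.coe_sub_sub_coe_nonneg_iff hr).1 hf)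
    rcases ha0.eq_or_lt with rfl | ha0
    · simpa using hlog
    · have : a / (1 - ρ) < a / (1 - ρ') :=
        div_lt_div_of_pos_left ha0 (by linarith) (by linarith)
      linarith
  have hbdd : BddAbove {h : ℝ | 0 ≤ h ∧ 0 ≤ gG μ X m θ a ρ h} := by
    refine ⟨xStar μ X m * (1 - ρ), fun h ⟨hh0, hh⟩ => ?_⟩
    have hle : (h + θ * xStar μ X m) / (1 - ρ) ≤ xStar μ X m := by
      refine le_csSup hxB ⟨by positivity, ((gG_nonneg_iff h).1 hh).trans ?_⟩
      have : 0 ≤ a / (1 - ρ) := by positivity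
      exact_mod_cast sub_le_self _ this
    rw [div_le_iff₀ hρ1] at hle
    linarith
  refine ⟨fun ε hε => ?_, fun ε hε hεd => ?_⟩
  · have hd : 0 ≤ dD μ X m θ a ρ := Real.sSup_nonneg fun h hh => hh.1
    by_contra! hcon
    have : dD μ X m θ a ρ + ε ≤ dD μ X m θ a ρ := le_csSup hbdd ⟨by linarith, hcon⟩
    linarith
  · set h := dD μ X m θ a ρ - ε with hh
    have hpos : 0 < h := by linarith
    obtain ⟨h', ⟨-, hg'⟩, hlt⟩ : ∃ h' ∈ {h : ℝ | 0 ≤ h ∧ 0 ≤ gG μ X m θ a ρ h}, h < h' := by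
      refine exists_lt_of_lt_csSup (Set.nonempty_iff_ne_empty.2 fun hempty => ?_)
        (show h < dD μ X m θ a ρ by linarith)
      rw [dD, hempty, Real.sSup_empty] at hεd
      exact hεd.not_gt hε
    set s := (h + θ * xStar μ X m) / (h' + θ * xStar μ X m) with hs
    have hden : 0 < h' + θ * xStar μ X m := by linarith
    have hs0 : 0 ≤ s := by positivity
    have hs1 : s < 1 := by rw [hs, div_lt_one hden]; linarith
    have hmul : s * ((h' + θ * xStar μ X m) / (1 - ρ)) = (h + θ * xStar μ X m) / (1 - ρ) := by
      rw [hs]; field_simp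
    have hle := rateI_mul_le hint hmean hs0 hs1.le ((gG_nonneg_iff h').1 hg')
    rw [hmul] at hle
    refine (EReal.coe_sub_sub_coe_pos_iff (rateI_nonneg μ X _)).2 (hle.trans_lt ?_)
    exact_mod_cast mul_lt_of_lt_one_left hc hs1
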